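/- Let B ⊂ ℝ^n be a ball centered at 0 and let u(x) = (1/2)·x_n² for x_n > 0, u(x) = 0 for x_n ≤ 0. Then for every v ∈ H²(B) with v − u ∈ H₀²(B) one has F(u,B) ≤ F(v,B), and equality holds if and only if Δv = χ_{{v ≠ 0}} almost everywhere on B. -/

import Mathlib

open MeasureTheory Metric Set Filter Topology
open scoped ENNReal

noncomputable section

/-- `n`-dimensional Euclidean space. -/
abbrev RH (n : ℕ) := EuclideanSpace ℝ (Fin n)

variable {n : ℕ}

/-- Smooth compactly supported test functions with support contained in `Ω`. -/
def IsTestFun (Ω : Set (RH n)) (φ : RH n → ℝ) : Prop :=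
  ContDiff ℝ (⊤ : ℕ∞) φ ∧ HasCompactSupport φ ∧ tsupport φ ⊆ Ω

/-- Classical partial derivative in the `i`-th coordinate direction. -/
def cpderiv (i : Fin n) (φ : RH n → ℝ) : RH n → ℝ :=
  fun x => fderiv ℝ φ x (EuclideanSpace.single i 1)

/-- Classical Laplacian of a (smooth) function. -/
def cLaplacian (φ : RH n → ℝ) : RH n → ℝ :=
  fun x => ∑ i, cpderiv i (cpderiv i φ) x

/-- `g` is the weak `i`-th partial derivative of `u` on `Ω`. -/
def IsWeakPartial (Ω : Set (RH n)) (i : Fin n) (u g : RH n → ℝ) : Prop :=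
  ∀ φ : RH n → ℝ, IsTestFun Ω φ →
    ∫ x in Ω, u x * cpderiv i φ x = - ∫ x in Ω, g x * φ x

/-- `g` is a weak Laplacian of `u` on `Ω`. -/
def IsWeakLaplacian (Ω : Set (RH n)) (u g : RH n → ℝ) : Prop :=
  ∀ φ : RH n → ℝ, IsTestFun Ω φ →
    ∫ x in Ω, u x * cLaplacian φ x = ∫ x in Ω, g x * φ x

/-- `u ∈ H²(Ω)` with weak gradient `g` and weak Hessian `h`. -/
def IsH2With (Ω : Set (RH n)) (u : RH n → ℝ) (g : Fin n → RH n → ℝ)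
    (h : Fin n → Fin n → RH n → ℝ) : Prop :=
  MemLp u 2 (volume.restrict Ω) ∧
  (∀ i, IsWeakPartial Ω i u (g i) ∧ MemLp (g i) 2 (volume.restrict Ω)) ∧
  (∀ i j, IsWeakPartial Ω j (g i) (h i j) ∧ MemLp (h i j) 2 (volume.restrict Ω))

/-- `u ∈ H²(Ω)`. -/
def MemH2 (Ω : Set (RH n)) (u : RH n → ℝ) : Prop :=
  ∃ g h, IsH2With Ω u g h

/-- `u ∈ H₀²(Ω)`: `u ∈ H²(Ω)` and `u` is approximable in the `H²`-norm by
test functions supported in `Ω`. -/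
def MemH20 (Ω : Set (RH n)) (u : RH n → ℝ) : Prop :=
  ∃ g h, IsH2With Ω u g h ∧
    ∃ φ : ℕ → RH n → ℝ, (∀ k, IsTestFun Ω (φ k)) ∧
      Tendsto (fun k => eLpNorm (fun x => u x - φ k x) 2 (volume.restrict Ω)) atTop (𝓝 0) ∧
      (∀ i, Tendsto (fun k => eLpNorm (fun x => g i x - cpderiv i (φ k) x) 2
        (volume.restrict Ω)) atTop (𝓝 0)) ∧
      (∀ i j, Tendsto (fun k => eLpNorm (fun x => h i j x - cpderiv j (cpderiv i (φ k)) x) 2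
        (volume.restrict Ω)) atTop (𝓝 0))

/-- `u ∈ H²_loc(ℝⁿ)`. -/
def MemH2loc (u : RH n → ℝ) : Prop :=
  ∀ Ω : Set (RH n), IsOpen Ω → Bornology.IsBounded Ω → MemH2 Ω u

/-- The two-sided biharmonic Alt–Caffarelli functional
`F(u,Ω) = ∫_Ω (Δu)² dx + |{x ∈ Ω : u x ≠ 0}|`, where the (weak) Laplacian
`Δu = lapu` is given explicitly. -/
def ACF (Ω : Set (RH n)) (lapu u : RH n → ℝ) : ℝ :=
  (∫ x in Ω, (lapu x) ^ 2) + (volume {x ∈ Ω | u x ≠ 0}).toReal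

/-- `u` is a global minimizer of the two-sided biharmonic Alt–Caffarelli functional. -/
def IsGlobalMinimizer (u : RH n → ℝ) : Prop :=
  MemH2loc u ∧
  ∀ Ω : Set (RH n), IsOpen Ω → Bornology.IsBounded Ω →
    ∀ v : RH n → ℝ, MemH2 Ω v → MemH20 Ω (fun x => v x - u x) →
      ∀ lapu lapv : RH n → ℝ, IsWeakLaplacian Ω u lapu → IsWeakLaplacian Ω v lapv →
        ACF Ω lapu u ≤ ACF Ω lapv v


/-- The half-space function `u(x) = ½ xₙ² 𝟙_{xₙ>0}`. -/
def uHalf (n : ℕ) (hn : 0 < n) : RH n → ℝ := fun x =>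
  if 0 < x ⟨n - 1, by omega⟩ then (x ⟨n - 1, by omega⟩) ^ 2 / 2 else 0


lemma contDiff_cpderiv {φ : RH n → ℝ} (h : ContDiff ℝ (⊤ : ℕ∞) φ) (i : Fin n) :
    ContDiff ℝ (⊤ : ℕ∞) (cpderiv i φ) :=
  (h.fderiv_right (m := (⊤ : ℕ∞)) le_rfl).clm_apply contDiff_const

lemma tsupport_cpderiv_subset (i : Fin n) (φ : RH n → ℝ) :
    tsupport (cpderiv i φ) ⊆ tsupport φ :=
  tsupport_fderiv_apply_subset ℝ _

lemma IsTestFun.pderiv {Ω : Set (RH n)} {φ : RH n → ℝ} (h : IsTestFun Ω φ) (i : Fin n) :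
    IsTestFun Ω (cpderiv i φ) :=
  ⟨contDiff_cpderiv h.1 i,
    h.2.1.mono' ((subset_tsupport _).trans (tsupport_cpderiv_subset i φ)),
    (tsupport_cpderiv_subset i φ).trans h.2.2⟩

lemma cpderiv_const (i : Fin n) (c : ℝ) : cpderiv i (fun _ : RH n => c) = fun _ => 0 := by
  ext x
  simp [cpderiv]

lemma IsTestFun.exists_bound {Ω : Set (RH n)} {φ : RH n → ℝ} (h : IsTestFun Ω φ) :
    ∃ C, ∀ x, ‖φ x‖ ≤ C :=
  h.2.1.exists_bound_of_continuous h.1.continuous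

lemma IsTestFun.eq_zero {Ω : Set (RH n)} {φ : RH n → ℝ} (h : IsTestFun Ω φ) {x : RH n}
    (hx : x ∉ Ω) : φ x = 0 :=
  image_eq_zero_of_notMem_tsupport fun hx' => hx (h.2.2 hx')

lemma IsTestFun.add {Ω : Set (RH n)} {φ ψ : RH n → ℝ} (h : IsTestFun Ω φ) (h' : IsTestFun Ω ψ) :
    IsTestFun Ω (fun x => φ x + ψ x) :=
  ⟨h.1.add h'.1, h.2.1.add h'.2.1, (tsupport_add φ ψ).trans (union_subset h.2.2 h'.2.2)⟩

lemma IsTestFun.setIntegral_mul {Ω : Set (RH n)} {φ : RH n → ℝ} (h : IsTestFun Ω φ)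
    (f : RH n → ℝ) : ∫ x in Ω, f x * φ x = ∫ x, f x * φ x :=
  setIntegral_eq_integral_of_forall_compl_eq_zero fun x hx => by rw [h.eq_zero hx, mul_zero]

/-- Integration by parts of a `C¹` function against a test function. -/
lemma integral_mul_cpderiv {Ω : Set (RH n)} {F η : RH n → ℝ} (i : Fin n)
    (hF : Differentiable ℝ F) (hF' : Continuous (cpderiv i F)) (hη : IsTestFun Ω η) :
    ∫ x, F x * cpderiv i η x = - ∫ x, cpderiv i F x * η x := by
  refine integral_mul_fderiv_eq_neg_fderiv_mul_of_integrable ?_ ?_ ?_ (fun x _ => hF x)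
    (fun x _ => hη.1.differentiable (by simp) x)
  · exact (hF'.mul hη.1.continuous).integrable_of_hasCompactSupport hη.2.1.mul_left
  · exact (hF.continuous.mul (hη.pderiv i).1.continuous).integrable_of_hasCompactSupport
      (hη.pderiv i).2.1.mul_left
  · exact (hF.continuous.mul hη.1.continuous).integrable_of_hasCompactSupport hη.2.1.mul_left

/-- The integral of a partial derivative of a test function vanishes. -/
lemma IsTestFun.setIntegral_cpderiv {Ω : Set (RH n)} {η : RH n → ℝ} (hη : IsTestFun Ω η)
    (i : Fin n) : ∫ x in Ω, cpderiv i η x = 0 := by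
  have h1 := integral_mul_cpderiv (F := fun _ => 1) i (differentiable_const _)
    (by rw [cpderiv_const]; exact continuous_const) hη
  have h2 := (hη.pderiv i).setIntegral_mul (fun _ => 1)
  simp only [one_mul, cpderiv_const, zero_mul, integral_zero, neg_zero] at h1 h2
  rw [h2, h1]

/-- Weak-strong convergence: bounded pointwise convergence times `L²` convergence. -/
lemma tendsto_integral_mul_of_eLpNorm {α : Type*} [MeasurableSpace α] {μ : Measure α}
    [IsFiniteMeasure μ] {a : ℕ → α → ℝ} {b : α → ℝ} {M : ℝ} {G : α → ℝ} {g : ℕ → α → ℝ}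
    (ha : ∀ k, AEStronglyMeasurable (a k) μ) (hM : ∀ k x, ‖a k x‖ ≤ M)
    (hab : ∀ᵐ x ∂μ, Tendsto (fun k => a k x) atTop (𝓝 (b x)))
    (hG : Integrable G μ) (hg : ∀ k, AEStronglyMeasurable (g k) μ)
    (hgG : Tendsto (fun k => eLpNorm (fun x => G x - g k x) 2 μ) atTop (𝓝 0)) :
    Tendsto (fun k => ∫ x, a k x * g k x ∂μ) atTop (𝓝 (∫ x, b x * G x ∂μ)) := by
  have hd : ∀ k, AEStronglyMeasurable (fun x => G x - g k x) μ := fun k =>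
    hG.aestronglyMeasurable.sub (hg k)
  have h1 : Tendsto (fun k => ∫ x, a k x * G x ∂μ) atTop (𝓝 (∫ x, b x * G x ∂μ)) := by
    refine tendsto_integral_of_dominated_convergence (fun x => M * ‖G x‖)
      (fun k => (ha k).mul hG.aestronglyMeasurable) (hG.norm.const_mul M) ?_ ?_
    · intro k
      refine Eventually.of_forall fun x => ?_
      rw [norm_mul]
      exact mul_le_mul_of_nonneg_right (hM k x) (norm_nonneg _)
    · filter_upwards [hab] with x hx using hx.mul_const _
  have hfin : ∀ᶠ k in atTop, Integrable (fun x => G x - g k x) μ := by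
    filter_upwards [hgG.eventually (gt_mem_nhds (show (0 : ℝ≥0∞) < 1 by simp))] with k hk
    exact MemLp.integrable (q := 2) (by norm_num) ⟨hd k, hk.trans ENNReal.one_lt_top⟩
  have h2 : Tendsto (fun k => ∫ x, a k x * (G x - g k x) ∂μ) atTop (𝓝 0) := by
    have hL1 : Tendsto (fun k => eLpNorm (fun x => G x - g k x) 1 μ) atTop (𝓝 0) := by
      have hc : μ univ ^ (1 / (1 : ℝ≥0∞).toReal - 1 / (2 : ℝ≥0∞).toReal) ≠ ∞ :=
        ENNReal.rpow_ne_top_of_nonneg (by norm_num) (measure_ne_top _ _)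
      have := ENNReal.Tendsto.mul_const hgG (Or.inr hc)
      rw [zero_mul] at this
      exact tendsto_of_tendsto_of_tendsto_of_le_of_le tendsto_const_nhds this
        (fun _ => zero_le) fun k => eLpNorm_le_eLpNorm_mul_rpow_measure_univ (by norm_num) (hd k)
    have hL : Tendsto (fun k => eLpNorm (fun x => a k x * (G x - g k x)) 1 μ) atTop (𝓝 0) := by
      have := ENNReal.Tendsto.const_mul hL1 (Or.inr (ENNReal.ofReal_ne_top (r := M)))
      rw [mul_zero] at this
      refine tendsto_of_tendsto_of_tendsto_of_le_of_le tendsto_const_nhds this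
        (fun _ => zero_le) fun k => ?_
      refine eLpNorm_le_mul_eLpNorm_of_ae_le_mul (Eventually.of_forall fun x => ?_) 1
      rw [norm_mul]
      exact mul_le_mul_of_nonneg_right (hM k x) (norm_nonneg _)
    have := tendsto_integral_of_L1' (μ := μ) (fun _ => (0 : ℝ)) aestronglyMeasurable_const
      (F := fun k x => a k x * (G x - g k x)) (l := atTop)
      (hfin.mono fun k hk => hk.bdd_mul (ha k) (Eventually.of_forall (hM k)))
      (by refine hL.congr fun k => ?_; congr 1; ext x; simp)
    simpa using this
  have h3 := h1.sub h2
  rw [sub_zero] at h3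
  refine h3.congr' ?_
  filter_upwards [hfin] with k hk
  rw [← integral_sub (hG.bdd_mul (ha k) (Eventually.of_forall (hM k)))
    (hk.bdd_mul (ha k) (Eventually.of_forall (hM k)))]
  exact integral_congr_ae (Eventually.of_forall fun x => by ring)

/-- If smooth functions `F k` converge to `f` and their partial derivatives to `G` in `L²(Ω)`,
then `G` vanishes almost everywhere on the zero set of `f`. -/
lemma ae_eq_zero_of_tendsto_eLpNorm_cpderiv {Ω : Set (RH n)} (hΩ : IsOpen Ω)
    (hΩ' : volume Ω ≠ ∞) (i : Fin n) {f G : RH n → ℝ} {F : ℕ → RH n → ℝ}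
    (hF : ∀ k, ContDiff ℝ (⊤ : ℕ∞) (F k)) (hf : AEStronglyMeasurable f (volume.restrict Ω))
    (hG : MemLp G 2 (volume.restrict Ω))
    (hlim : Tendsto (fun k => eLpNorm (fun x => f x - F k x) 2 (volume.restrict Ω)) atTop (𝓝 0))
    (hlim' : Tendsto (fun k => eLpNorm (fun x => G x - cpderiv i (F k) x) 2
      (volume.restrict Ω)) atTop (𝓝 0)) :
    ∀ᵐ x ∂volume.restrict Ω, f x = 0 → G x = 0 := by
  have : IsFiniteMeasure (volume.restrict Ω) := ⟨by simpa using hΩ'.lt_top⟩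
  have hGi : Integrable G (volume.restrict Ω) := hG.integrable (by norm_num)
  obtain ⟨ns, hns, hae⟩ := (tendstoInMeasure_of_tendsto_eLpNorm (μ := volume.restrict Ω)
    (f := F) (g := f) (p := 2) (l := atTop) (by norm_num)
    (fun k => (hF k).continuous.aestronglyMeasurable) hf
    (hlim.congr fun k => eLpNorm_sub_comm f (F k) 2 _)).exists_seq_tendsto_ae
  have hlim'' := hlim'.comp hns.tendsto_atTop
  have hbd : ∀ s t : ℝ, ‖(1 + (s * t) ^ 2)⁻¹‖ ≤ 1 := fun s t => by
    rw [norm_inv, Real.norm_of_nonneg (by positivity)]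
    exact inv_le_one_of_one_le₀ (by nlinarith [sq_nonneg (s * t)])
  have hcont : ∀ s : ℝ, Continuous fun t : ℝ => (1 + (s * t) ^ 2)⁻¹ := fun s =>
    Continuous.inv₀ (by fun_prop) fun t => by positivity
  set Z : Set (RH n) := {x | f x = 0} with hZ
  have hZm : NullMeasurableSet Z (volume.restrict Ω) :=
    nullMeasurableSet_eq_fun hf.aemeasurable aemeasurable_const
  have key : ∀ η, IsTestFun Ω η → ∫ x in Ω, Z.indicator G x * η x = 0 := by
    intro η hη
    obtain ⟨M, hM⟩ := hη.exists_bound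
    have hM0 : 0 ≤ M := (norm_nonneg _).trans (hM 0)
    have hDi : Integrable (cpderiv i η) := (hη.pderiv i).1.continuous.integrable_of_hasCompactSupport
      (hη.pderiv i).2.1
    have step : ∀ s : ℝ, 0 < s → ‖∫ x in Ω, ((1 + (s * f x) ^ 2)⁻¹ * η x) * G x‖
        ≤ (∫ x, Real.pi / 2 * ‖cpderiv i η x‖) * s⁻¹ := by
      intro s hs
      have hT := tendsto_integral_mul_of_eLpNorm (μ := volume.restrict Ω)
        (a := fun k x => (1 + (s * F (ns k) x) ^ 2)⁻¹ * η x)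
        (b := fun x => (1 + (s * f x) ^ 2)⁻¹ * η x) (M := M) (G := G)
        (g := fun k => cpderiv i (F (ns k)))
        (fun k => (((hcont s).comp (hF _).continuous).mul
          hη.1.continuous).aestronglyMeasurable)
        (fun k x => by
          rw [norm_mul]
          exact (mul_le_mul (hbd _ _) (hM x) (norm_nonneg _) zero_le_one).trans (one_mul M).le)
        (by
          filter_upwards [hae] with x hx
          exact (((hcont s).tendsto _).comp hx).mul_const _)
        hGi (fun k => (contDiff_cpderiv (hF _) i).continuous.aestronglyMeasurable) hlim''
      refine le_of_tendsto hT.norm (Eventually.of_forall fun k => ?_)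
      set P := F (ns k) with hP
      have hPd : Differentiable ℝ P := (hF _).differentiable (by simp)
      have hder : ∀ x, HasFDerivAt (fun x => Real.arctan (s * P x) * s⁻¹)
          ((1 + (s * P x) ^ 2)⁻¹ • fderiv ℝ P x) x := by
        intro x
        have h1 := (((hPd x).hasFDerivAt.const_mul s).arctan).mul_const s⁻¹
        refine h1.congr_fderiv ?_
        rw [smul_smul, smul_smul]
        congr 1
        field_simp
      have hcp : cpderiv i (fun x => Real.arctan (s * P x) * s⁻¹)
          = fun x => (1 + (s * P x) ^ 2)⁻¹ * cpderiv i P x := by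
        ext x
        simp [cpderiv, (hder x).fderiv]
      have hibp := integral_mul_cpderiv (F := fun x => Real.arctan (s * P x) * s⁻¹) i
        (fun x => (hder x).differentiableAt)
        (by
          rw [hcp]
          exact ((hcont s).comp hPd.continuous).mul (contDiff_cpderiv (hF _) i).continuous) hη
      have h2 : ∫ x in Ω, (1 + (s * P x) ^ 2)⁻¹ * η x * cpderiv i P x
          = - ∫ x, Real.arctan (s * P x) * s⁻¹ * cpderiv i η x := by
        rw [hibp, neg_neg, hcp, ← hη.setIntegral_mul]
        exact integral_congr_ae (Eventually.of_forall fun x => by ring)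
      rw [h2, norm_neg, ← integral_mul_const]
      refine norm_integral_le_of_norm_le ((hDi.norm.const_mul _).mul_const _)
        (Eventually.of_forall fun x => ?_)
      rw [norm_mul, norm_mul, Real.norm_of_nonneg (inv_nonneg.2 hs.le), mul_right_comm]
      gcongr
      exact abs_le.2 ⟨by linarith [Real.neg_pi_div_two_lt_arctan (s * P x)],
        (Real.arctan_lt_pi_div_two _).le⟩
    have hD : Tendsto (fun m : ℕ => ∫ x in Ω, ((1 + ((m : ℝ) * f x) ^ 2)⁻¹ * η x) * G x) atTop
        (𝓝 (∫ x in Ω, Z.indicator G x * η x)) := by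
      refine tendsto_integral_of_dominated_convergence (fun x => M * ‖G x‖)
        (fun m => ((((hcont m).comp_aestronglyMeasurable hf)).mul
          hη.1.continuous.aestronglyMeasurable).mul hGi.aestronglyMeasurable)
        (hGi.norm.const_mul M) ?_ ?_
      · refine fun m => Eventually.of_forall fun x => ?_
        rw [norm_mul, norm_mul]
        gcongr
        exact (mul_le_mul (hbd _ _) (hM x) (norm_nonneg _) zero_le_one).trans (one_mul M).le
      · refine Eventually.of_forall fun x => ?_
        by_cases hx : f x = 0
        · have : x ∈ Z := hx
          simp [hx, this, mul_comm]
        · have hx' : x ∉ Z := hx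
          have h1 : Tendsto (fun m : ℕ => 1 + ((m : ℝ) * f x) ^ 2) atTop atTop := by
            refine tendsto_atTop_add_const_left _ _ ?_
            simp only [mul_pow]
            exact ((tendsto_pow_atTop two_ne_zero).comp
              tendsto_natCast_atTop_atTop).atTop_mul_const (by positivity)
          have := (h1.inv_tendsto_atTop.mul_const (η x)).mul_const (G x)
          simpa [hx'] using this
    have h0 : Tendsto (fun m : ℕ => ∫ x in Ω, ((1 + ((m : ℝ) * f x) ^ 2)⁻¹ * η x) * G x) atTop
        (𝓝 0) := by
      rw [tendsto_zero_iff_norm_tendsto_zero]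
      have hi := (tendsto_inv_atTop_nhds_zero_nat (𝕜 := ℝ)).const_mul
        (∫ x, Real.pi / 2 * ‖cpderiv i η x‖)
      rw [mul_zero] at hi
      refine tendsto_of_tendsto_of_tendsto_of_le_of_le' tendsto_const_nhds hi
        (Eventually.of_forall fun _ => norm_nonneg _) ?_
      filter_upwards [eventually_gt_atTop 0] with m hm using step m (by exact_mod_cast hm)
    exact tendsto_nhds_unique hD h0
  have hloc : LocallyIntegrableOn (Z.indicator G) Ω :=
    IntegrableOn.locallyIntegrableOn (show Integrable _ (volume.restrict Ω) from
      hGi.indicator₀ hZm)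
  have := hΩ.ae_eq_zero_of_integral_contDiff_smul_eq_zero hloc fun η h1 h2 h3 => by
    have hη : IsTestFun Ω η := ⟨h1, h2, h3⟩
    rw [← key η hη, hη.setIntegral_mul]
    exact integral_congr_ae (Eventually.of_forall fun x => by simp [mul_comm])
  rw [ae_restrict_iff' hΩ.measurableSet]
  filter_upwards [this] with x hx hxΩ hfx
  have hxZ : x ∈ Z := hfx
  simpa [hxZ] using hx hxΩ

lemma memLp_two_restrict_of_continuous {Ω : Set (RH n)} (hΩ : Bornology.IsBounded Ω)
    {p : RH n → ℝ} (hp : Continuous p) : MemLp p 2 (volume.restrict Ω) := by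
  have : IsFiniteMeasure (volume.restrict Ω) := ⟨by simpa using hΩ.measure_lt_top⟩
  obtain ⟨C, hC⟩ := hΩ.isCompact_closure.exists_bound_of_continuousOn hp.continuousOn
  refine MemLp.of_bound hp.aestronglyMeasurable C ?_
  exact ae_restrict_of_ae_restrict_of_subset subset_closure
    (ae_restrict_of_forall_mem isClosed_closure.measurableSet hC)

lemma cpderiv_add {f g : RH n → ℝ} (i : Fin n) (hf : ContDiff ℝ (⊤ : ℕ∞) f)
    (hg : ContDiff ℝ (⊤ : ℕ∞) g) (x : RH n) :
    cpderiv i (fun y => f y + g y) x = cpderiv i f x + cpderiv i g x := by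
  have := fderiv_fun_add (hf.differentiable (by simp) x) (hg.differentiable (by simp) x)
  simp [cpderiv, this]

/-- If `ψ` is an `H²(Ω)`-limit of smooth functions `φ k`, with weak Hessian `h`, and `p` is
smooth, then the Laplacian of `ψ + p` vanishes almost everywhere on the zero set of `ψ + p`. -/
lemma ae_laplacian_eq_zero {Ω : Set (RH n)} (hΩ : IsOpen Ω) (hb : Bornology.IsBounded Ω)
    {ψ : RH n → ℝ} {g : Fin n → RH n → ℝ} {h : Fin n → Fin n → RH n → ℝ}
    {φ : ℕ → RH n → ℝ} {p : RH n → ℝ} (hψ : MemLp ψ 2 (volume.restrict Ω))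
    (hg : ∀ i, MemLp (g i) 2 (volume.restrict Ω))
    (hh : ∀ i j, MemLp (h i j) 2 (volume.restrict Ω))
    (hφ : ∀ k, ContDiff ℝ (⊤ : ℕ∞) (φ k))
    (h0 : Tendsto (fun k => eLpNorm (fun x => ψ x - φ k x) 2 (volume.restrict Ω)) atTop (𝓝 0))
    (h1 : ∀ i, Tendsto (fun k => eLpNorm (fun x => g i x - cpderiv i (φ k) x) 2
        (volume.restrict Ω)) atTop (𝓝 0))
    (h2 : ∀ i j, Tendsto (fun k => eLpNorm (fun x => h i j x - cpderiv j (cpderiv i (φ k)) x) 2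
        (volume.restrict Ω)) atTop (𝓝 0))
    (hp : ContDiff ℝ (⊤ : ℕ∞) p) :
    ∀ᵐ x ∂volume.restrict Ω, ψ x + p x = 0 → ∑ i, h i i x + cLaplacian p x = 0 := by
  have hL : ∀ {q : RH n → ℝ}, ContDiff ℝ (⊤ : ℕ∞) q → MemLp q 2 (volume.restrict Ω) :=
    fun hq => memLp_two_restrict_of_continuous hb hq.continuous
  have A : ∀ i, ∀ᵐ x ∂volume.restrict Ω, ψ x + p x = 0 → g i x + cpderiv i p x = 0 := fun i =>
    ae_eq_zero_of_tendsto_eLpNorm_cpderiv hΩ hb.measure_lt_top.ne i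
      (f := fun x => ψ x + p x) (F := fun k x => φ k x + p x)
      (G := fun x => g i x + cpderiv i p x) (fun k => (hφ k).add hp)
      (hψ.add (hL hp)).aestronglyMeasurable ((hg i).add (hL (contDiff_cpderiv hp i)))
      (by simpa using h0)
      (by simpa [cpderiv_add i (hφ _) hp] using h1 i)
  have B : ∀ i, ∀ᵐ x ∂volume.restrict Ω, g i x + cpderiv i p x = 0 →
      h i i x + cpderiv i (cpderiv i p) x = 0 := fun i =>
    ae_eq_zero_of_tendsto_eLpNorm_cpderiv hΩ hb.measure_lt_top.ne i
      (f := fun x => g i x + cpderiv i p x) (F := fun k x => cpderiv i (φ k) x + cpderiv i p x)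
      (G := fun x => h i i x + cpderiv i (cpderiv i p) x)
      (fun k => (contDiff_cpderiv (hφ k) i).add (contDiff_cpderiv hp i))
      ((hg i).add (hL (contDiff_cpderiv hp i))).aestronglyMeasurable
      ((hh i i).add (hL (contDiff_cpderiv (contDiff_cpderiv hp i) i)))
      (by simpa using h1 i)
      (by simpa [cpderiv_add i (contDiff_cpderiv (hφ _) i) (contDiff_cpderiv hp i)] using h2 i i)
  filter_upwards [ae_all_iff.2 A, ae_all_iff.2 B] with x hA hB hx
  rw [cLaplacian, ← Finset.sum_add_distrib]
  exact Finset.sum_eq_zero fun i _ => hB i (hA i hx)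

lemma IsH2With.isWeakLaplacian {Ω : Set (RH n)} (hb : Bornology.IsBounded Ω) {ψ : RH n → ℝ}
    {g : Fin n → RH n → ℝ} {h : Fin n → Fin n → RH n → ℝ} (H : IsH2With Ω ψ g h) :
    IsWeakLaplacian Ω ψ (fun x => ∑ i, h i i x) := by
  have : IsFiniteMeasure (volume.restrict Ω) := ⟨by simpa using hb.measure_lt_top⟩
  have hint : ∀ {f η : RH n → ℝ}, MemLp f 2 (volume.restrict Ω) → IsTestFun Ω η →
      Integrable (fun x => f x * η x) (volume.restrict Ω) := fun hf hη => by
    obtain ⟨C, hC⟩ := hη.exists_bound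
    exact (hf.integrable (by norm_num)).mul_bdd hη.1.continuous.aestronglyMeasurable
      (Eventually.of_forall hC)
  intro η hη
  simp only [cLaplacian, Finset.mul_sum, Finset.sum_mul]
  rw [integral_finsetSum _ fun i _ => hint H.1 ((hη.pderiv i).pderiv i),
    integral_finsetSum _ fun i _ => hint (H.2.2 i i).2 hη]
  refine Finset.sum_congr rfl fun i _ => ?_
  rw [(H.2.1 i).1 _ (hη.pderiv i), (H.2.2 i i).1 _ hη, neg_neg]

/-- The pairing with test functions determines an integrable function `w` almost everywhere, even
against a candidate `l` that is not assumed to be locally integrable, unless `w` vanishes. -/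
lemma ae_eq_zero_or_ae_eq_of_forall_isTestFun {Ω : Set (RH n)} (hΩ : IsOpen Ω) {w l : RH n → ℝ}
    (hw : IntegrableOn w Ω)
    (H : ∀ η, IsTestFun Ω η → ∫ x in Ω, w x * η x = ∫ x in Ω, l x * η x) :
    (∀ᵐ x ∂volume.restrict Ω, w x = 0) ∨ ∀ᵐ x ∂volume.restrict Ω, l x = w x := by
  have hwη : ∀ {η}, IsTestFun Ω η → IntegrableOn (fun x => w x * η x) Ω := fun hη => by
    obtain ⟨C, hC⟩ := hη.exists_bound
    exact hw.mul_bdd hη.1.continuous.aestronglyMeasurable (Eventually.of_forall hC)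
  by_cases hl : LocallyIntegrableOn l Ω
  · right
    have hlη : ∀ {η}, IsTestFun Ω η → IntegrableOn (fun x => l x * η x) Ω := fun {η} hη => by
      have h1 : IntegrableOn (fun x => l x * η x) (tsupport η) :=
        (hl.integrableOn_compact_subset hη.2.2 hη.2.1).mul_continuousOn
          hη.1.continuous.continuousOn hη.2.1
      refine (integrableOn_iff_integrable_of_support_subset ?_).1 h1 |>.integrableOn
      exact (Function.support_mul_subset_right _ _).trans (subset_tsupport η)
    have := hΩ.ae_eq_zero_of_integral_contDiff_smul_eq_zero
      (hl.sub hw.locallyIntegrableOn) fun η h1 h2 h3 => by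
        have hη : IsTestFun Ω η := ⟨h1, h2, h3⟩
        have h4 := integral_sub (hlη hη) (hwη hη)
        rw [← H η hη, sub_self] at h4
        rw [← h4]
        have h5 := hη.setIntegral_mul (l - w)
        simp only [Pi.sub_apply, sub_mul] at h5
        rw [h5]
        exact integral_congr_ae (Eventually.of_forall fun x => by simp; ring)
    rw [ae_restrict_iff' hΩ.measurableSet]
    filter_upwards [this] with x hx hxΩ using sub_eq_zero.1 (hx hxΩ)
  · left
    obtain ⟨x₀, hx₀, hnot⟩ : ∃ x₀ ∈ Ω, ¬ IntegrableAtFilter l (𝓝[Ω] x₀) := by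
      simpa [LocallyIntegrableOn] using hl
    have hz : ∀ η, IsTestFun Ω η → η x₀ ≠ 0 → ∫ x in Ω, w x * η x = 0 := by
      intro η hη hne
      rw [H η hη]
      refine integral_undef fun hi => hnot ?_
      set U : Set (RH n) := {x | ‖η x₀‖ / 2 < ‖η x‖} with hU
      have hUo : IsOpen U := isOpen_lt continuous_const hη.1.continuous.norm
      have hpos : 0 < ‖η x₀‖ := norm_pos_iff.2 hne
      have hxU : x₀ ∈ U := by simp only [hU, mem_ofPred_eq]; linarith
      refine ⟨Ω ∩ U, inter_mem_nhdsWithin _ (hUo.mem_nhds hxU), ?_⟩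
      have h1 : IntegrableOn (fun x => (l x * η x) * (η x)⁻¹) (Ω ∩ U) := by
        refine Integrable.mul_bdd (c := (‖η x₀‖ / 2)⁻¹) (IntegrableOn.mono_set hi inter_subset_left)
          hη.1.continuous.measurable.inv.aestronglyMeasurable ?_
        refine ae_restrict_of_forall_mem (hΩ.measurableSet.inter hUo.measurableSet) fun x hx => ?_
        rw [norm_inv]
        exact inv_anti₀ (by positivity) (le_of_lt hx.2)
      refine h1.congr_fun (fun x hx => ?_) (hΩ.measurableSet.inter hUo.measurableSet)
      have : η x ≠ 0 := norm_pos_iff.1 ((half_pos hpos).trans hx.2)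
      simp [this]
    obtain ⟨χ, h1, h2, h3, -, h5⟩ := exists_contDiff_tsupport_subset (n := (⊤ : ℕ∞))
      (hΩ.mem_nhds hx₀)
    have hχ : IsTestFun Ω χ := ⟨h3, h2, h1⟩
    have hz' : ∀ η, IsTestFun Ω η → ∫ x in Ω, w x * η x = 0 := by
      intro η hη
      by_cases hne : η x₀ = 0
      · have h6 := hz _ (hη.add hχ) (by simp [hne, h5])
        simp only [mul_add] at h6
        rw [integral_add (hwη hη) (hwη hχ), hz χ hχ (by simp [h5]), add_zero] at h6
        exact h6
      · exact hz η hη hne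
    have := hΩ.ae_eq_zero_of_integral_contDiff_smul_eq_zero
      hw.locallyIntegrableOn fun η h1 h2 h3 => by
        have hη : IsTestFun Ω η := ⟨h1, h2, h3⟩
        rw [← hz' η hη, hη.setIntegral_mul]
        exact integral_congr_ae (Eventually.of_forall fun x => by simp [mul_comm])
    rw [ae_restrict_iff' hΩ.measurableSet]
    exact this

lemma hasDerivAt_half_sq_pos (t : ℝ) :
    HasDerivAt (fun s : ℝ => if 0 < s then s ^ 2 / 2 else 0) (max t 0) t := by
  rcases lt_trichotomy t 0 with ht | rfl | ht
  · rw [max_eq_right ht.le]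
    refine (hasDerivAt_const t (0 : ℝ)).congr_of_eventuallyEq ?_
    filter_upwards [gt_mem_nhds ht] with s hs using if_neg hs.le.not_gt
  · rw [max_self, hasDerivAt_iff_hasFDerivAt]
    have : (fun s : ℝ => if 0 < s then s ^ 2 / 2 else 0) =O[𝓝 0] fun s => ‖s - 0‖ ^ 2 := by
      refine Asymptotics.IsBigO.of_bound 1 (Eventually.of_forall fun s => ?_)
      simp only [sub_zero, norm_pow, Real.norm_eq_abs, sq_abs, one_mul]
      split_ifs
      · rw [abs_of_nonneg (by positivity)]
        linarith [sq_nonneg s]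
      · simpa using sq_nonneg s
    exact (this.hasFDerivAt (𝕜 := ℝ) one_lt_two).congr_fderiv (by ext; simp)
  · rw [max_eq_left ht.le]
    have : HasDerivAt (fun s : ℝ => s ^ 2 / 2) t t := by
      simpa using (hasDerivAt_pow 2 t).div_const 2
    refine this.congr_of_eventuallyEq ?_
    filter_upwards [lt_mem_nhds ht] with s hs using if_pos hs

lemma hasDerivAt_max_zero {t : ℝ} (ht : t ≠ 0) :
    HasDerivAt (fun s : ℝ => max s 0) (if 0 < t then 1 else 0) t := by
  rcases ht.lt_or_gt with ht | ht
  · rw [if_neg ht.le.not_gt]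
    refine (hasDerivAt_const t (0 : ℝ)).congr_of_eventuallyEq ?_
    filter_upwards [gt_mem_nhds ht] with s hs using max_eq_right hs.le
  · rw [if_pos ht]
    refine (hasDerivAt_id t).congr_of_eventuallyEq ?_
    filter_upwards [lt_mem_nhds ht] with s hs using max_eq_left hs.le

lemma hasFDerivAt_comp_coord {θ : ℝ → ℝ} {d : ℝ} (N : Fin n) {x : RH n}
    (h : HasDerivAt θ d (x N)) :
    HasFDerivAt (fun y : RH n => θ (y N)) (d • (EuclideanSpace.proj N : RH n →L[ℝ] ℝ)) x :=
  h.comp_hasFDerivAt x (EuclideanSpace.proj N : RH n →L[ℝ] ℝ).hasFDerivAt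

lemma cpderiv_comp_coord {θ θ' : ℝ → ℝ} (h : ∀ t, HasDerivAt θ (θ' t) t) (i N : Fin n) :
    cpderiv i (fun y : RH n => θ (y N)) = fun x => θ' (x N) * if N = i then 1 else 0 := by
  ext x
  simp [cpderiv, (hasFDerivAt_comp_coord N (h (x N))).fderiv]

lemma ae_coord_ne_zero (N : Fin n) : ∀ᵐ x : RH n, x N ≠ 0 := by
  have h := Measure.addHaar_submodule (volume : Measure (RH n))
    (LinearMap.ker (EuclideanSpace.proj N : RH n →L[ℝ] ℝ).toLinearMap) (fun h => by
      have h1 : EuclideanSpace.single N (1 : ℝ) ∈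
        LinearMap.ker (EuclideanSpace.proj N : RH n →L[ℝ] ℝ).toLinearMap := by simp [h]
      simp at h1)
  rw [ae_iff]
  convert h using 2
  ext x
  simp

/-- The weak Laplacian of `½ (x_N)₊²` is the characteristic function of `{x_N > 0}`. -/
lemma isWeakLaplacian_half_sq_pos (Ω : Set (RH n)) (N : Fin n) :
    IsWeakLaplacian Ω (fun x => if 0 < x N then (x N) ^ 2 / 2 else 0)
      (fun x => if 0 < x N then 1 else 0) := by
  intro η hη
  set u : RH n → ℝ := fun x => if 0 < x N then (x N) ^ 2 / 2 else 0 with hu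
  have hcp : ∀ i, cpderiv i u = fun x => max (x N) 0 * if N = i then 1 else 0 := fun i =>
    cpderiv_comp_coord hasDerivAt_half_sq_pos i N
  have hud : Differentiable ℝ u := fun x =>
    (hasFDerivAt_comp_coord N (hasDerivAt_half_sq_pos (x N))).differentiableAt
  have hcont : Continuous fun x : RH n => max (x N) 0 := by fun_prop
  have hterm : ∀ i, ∫ x in Ω, u x * cpderiv i (cpderiv i η) x
      = if N = i then - ∫ x, max (x N) 0 * cpderiv N η x else 0 := by
    intro i
    rw [((hη.pderiv i).pderiv i).setIntegral_mul, integral_mul_cpderiv i hud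
      (by rw [hcp]; exact hcont.mul continuous_const) (hη.pderiv i), hcp]
    split_ifs with h
    · subst h; simp
    · simp
  obtain ⟨D, hD⟩ := ContDiff.lipschitzWith_of_hasCompactSupport hη.2.1 hη.1 (by simp)
  have hlip : LipschitzWith ‖(EuclideanSpace.proj N : RH n →L[ℝ] ℝ)‖₊
      fun x : RH n => max (x N) 0 :=
    (EuclideanSpace.proj N : RH n →L[ℝ] ℝ).lipschitz.max_const 0
  have hibp := hlip.integral_lineDeriv_mul_eq (μ := volume) hD hη.2.1 (EuclideanSpace.single N 1)
  have h1 : ∫ x, lineDeriv ℝ (fun x : RH n => max (x N) 0) x (EuclideanSpace.single N 1) * η x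
      = ∫ x, (if 0 < x N then 1 else 0) * η x := by
    refine integral_congr_ae ?_
    filter_upwards [ae_coord_ne_zero N] with x hx
    have := hasFDerivAt_comp_coord N (hasDerivAt_max_zero hx)
    rw [this.differentiableAt.lineDeriv_eq_fderiv, this.fderiv]
    split_ifs <;> simp
  have h2 : ∫ x, lineDeriv ℝ η x (-EuclideanSpace.single N 1) * max (x N) 0
      = - ∫ x, max (x N) 0 * cpderiv N η x := by
    rw [← integral_neg]
    refine integral_congr_ae (Eventually.of_forall fun x => ?_)
    simp only
    rw [(hη.1.differentiable (by simp) x).lineDeriv_eq_fderiv, map_neg, cpderiv]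
    ring
  simp only [cLaplacian, Finset.mul_sum]
  rw [integral_finsetSum]
  · simp only [hterm, Finset.sum_ite_eq, Finset.mem_univ, if_true]
    rw [← h2, ← hibp, h1, hη.setIntegral_mul]
  · intro i _
    exact ((hud.continuous.mul ((hη.pderiv i).pderiv i).1.continuous
      ).integrable_of_hasCompactSupport ((hη.pderiv i).pderiv i).2.1.mul_left).integrableOn

lemma cLaplacian_half_sq (N : Fin n) (x : RH n) :
    cLaplacian (fun y : RH n => (y N) ^ 2 / 2) x = 1 := by
  have h1 : ∀ i, cpderiv i (fun y : RH n => (y N) ^ 2 / 2)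
      = fun x => x N * if N = i then 1 else 0 := fun i =>
    cpderiv_comp_coord (θ := fun t => t ^ 2 / 2) (θ' := fun t => t)
      (fun t => by simpa using (hasDerivAt_pow 2 t).div_const 2) i N
  have h2 : ∀ i, cpderiv i (fun x : RH n => x N * if N = i then 1 else 0)
      = fun _ => (if N = i then 1 else 0) * if N = i then 1 else 0 := fun i =>
    cpderiv_comp_coord (θ := fun t => t * if N = i then 1 else 0)
      (θ' := fun _ => if N = i then 1 else 0)
      (fun t => by simpa using (hasDerivAt_id t).mul_const (if N = i then (1 : ℝ) else 0)) i N
  simp only [cLaplacian, h1, h2]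
  simp

/-- Completing the square in the Alt–Caffarelli functional. -/
lemma ACF_eq_integral_sq_add {Ω : Set (RH n)} (hΩ : MeasurableSet Ω) (hΩ' : volume Ω ≠ ∞)
    {l v : RH n → ℝ} (hl : MemLp l 2 (volume.restrict Ω))
    (hv : AEStronglyMeasurable v (volume.restrict Ω))
    (hz : ∀ᵐ x ∂volume.restrict Ω, v x = 0 → l x = 0) :
    Integrable (fun x => (l x - if v x ≠ 0 then 1 else 0) ^ 2) (volume.restrict Ω) ∧
    ACF Ω l v = (∫ x in Ω, (l x - if v x ≠ 0 then 1 else 0) ^ 2) + 2 * ∫ x in Ω, l x := by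
  have : IsFiniteMeasure (volume.restrict Ω) := ⟨by simpa using hΩ'.lt_top⟩
  set Z : Set (RH n) := {x | v x ≠ 0} with hZ
  have hZm : NullMeasurableSet Z (volume.restrict Ω) :=
    (nullMeasurableSet_eq_fun hv.aemeasurable aemeasurable_const).compl
  set χ : RH n → ℝ := fun x => if v x ≠ 0 then 1 else 0 with hχ
  have hχZ : χ = Z.indicator fun _ => 1 := by
    ext x
    simp [hχ, hZ, indicator_apply]
  have hχi : Integrable χ (volume.restrict Ω) := by
    rw [hχZ]
    exact (integrable_const 1).indicator₀ hZm
  have hχ2 : MemLp χ 2 (volume.restrict Ω) :=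
    MemLp.of_bound hχi.aestronglyMeasurable 1 (Eventually.of_forall fun x => by
      simp only [hχ]; split_ifs <;> simp)
  have hsq : Integrable (fun x => (l x - χ x) ^ 2) (volume.restrict Ω) :=
    (hl.sub hχ2).integrable_sq
  refine ⟨hsq, ?_⟩
  have hvol : (volume {x ∈ Ω | v x ≠ 0}).toReal = ∫ x in Ω, χ x := by
    rw [hχZ, integral_indicator₀ hZm, setIntegral_const, smul_eq_mul, mul_one, measureReal_def,
      Measure.restrict_apply' hΩ, inter_comm]
    rfl
  rw [ACF, hvol, ← integral_add hl.integrable_sq hχi, ← integral_const_mul,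
    ← integral_add hsq ((hl.integrable (by norm_num)).const_mul 2)]
  refine integral_congr_ae ?_
  filter_upwards [hz] with x hx
  by_cases h : v x = 0
  · simp [hχ, h, hx h]
  · simp only [hχ, ne_eq, h, not_false_eq_true, if_true]
    ring

lemma not_ae_coord_nonpos_ball {R : ℝ} (hR : 0 < R) (N : Fin n) :
    ¬ ∀ᵐ x ∂volume.restrict (ball (0 : RH n) R), ¬ 0 < x N := by
  intro h
  rw [ae_restrict_iff' measurableSet_ball] at h
  have hne : (ball (0 : RH n) R ∩ {x | 0 < x N}).Nonempty :=
    ⟨EuclideanSpace.single N (R / 2), by simp [abs_of_pos hR]; linarith, by simpa using hR⟩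
  have ho : IsOpen (ball (0 : RH n) R ∩ {x | 0 < x N}) :=
    isOpen_ball.inter (isOpen_lt continuous_const (by fun_prop))
  refine (ho.measure_pos volume hne).ne' ?_
  rw [ae_iff] at h
  convert h using 2
  ext x
  simp

/-- the half-space function minimizes `F` in every ball centered at
the origin, with equality iff `Δv = χ_{{v ≠ 0}}` a.e. on `B`. (Here
`Δu = 𝟙_{xₙ > 0}` is the weak Laplacian of `u`.) -/
theorem statement5 (n : ℕ) (hn : 0 < n) (R : ℝ) (hR : 0 < R)
    (v lapv : RH n → ℝ) (hv : MemH2 (ball (0 : RH n) R) v)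
    (hv0 : MemH20 (ball (0 : RH n) R) (fun x => v x - uHalf n hn x))
    (hlapv : IsWeakLaplacian (ball (0 : RH n) R) v lapv) :
    ACF (ball (0 : RH n) R)
        (fun x => if 0 < x ⟨n - 1, by omega⟩ then 1 else 0) (uHalf n hn)
      ≤ ACF (ball (0 : RH n) R) lapv v ∧
    (ACF (ball (0 : RH n) R)
        (fun x => if 0 < x ⟨n - 1, by omega⟩ then 1 else 0) (uHalf n hn)
      = ACF (ball (0 : RH n) R) lapv v ↔
      ∀ᵐ (x : RH n) ∂volume.restrict (ball (0 : RH n) R),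
        lapv x = if v x ≠ 0 then 1 else 0) := by
  have hb : Bornology.IsBounded (ball (0 : RH n) R) := isBounded_ball
  set B : Set (RH n) := ball (0 : RH n) R with hB
  have : IsFiniteMeasure (volume.restrict B) := ⟨by simpa using hb.measure_lt_top⟩
  set N : Fin n := ⟨n - 1, by omega⟩ with hN
  set e : RH n → ℝ := fun x => if 0 < x N then 1 else 0 with he
  obtain ⟨g, h, H2, φ, hφ, l0, l1, l2⟩ := hv0
  set w : RH n → ℝ := fun x => ∑ i, h i i x + e x with hw
  have hem : Measurable e :=
    Measurable.ite (measurableSet_lt measurable_const (by fun_prop)) measurable_const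
      measurable_const
  have he2 : MemLp e 2 (volume.restrict B) :=
    MemLp.of_bound hem.aestronglyMeasurable 1 (Eventually.of_forall fun x => by
      simp only [he]; split_ifs <;> simp)
  have hh2 : MemLp (fun x => ∑ i, h i i x) 2 (volume.restrict B) :=
    memLp_finsetSum _ fun i _ => (H2.2.2 i i).2
  have hw2 : MemLp w 2 (volume.restrict B) := hh2.add he2
  have hei : Integrable e (volume.restrict B) := he2.integrable (by norm_num)
  obtain ⟨gv, hgv, Hv⟩ := hv
  have hvm : AEStronglyMeasurable v (volume.restrict B) := Hv.1.aestronglyMeasurable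
  have hucont : Continuous (uHalf n hn) := by
    have : Differentiable ℝ (uHalf n hn) := fun x =>
      (hasFDerivAt_comp_coord N (hasDerivAt_half_sq_pos (x N))).differentiableAt
    exact this.continuous
  have hu2 : MemLp (uHalf n hn) 2 (volume.restrict B) :=
    memLp_two_restrict_of_continuous hb hucont
  -- The weak Laplacian of `v` is `w`.
  have hwlap : ∀ η, IsTestFun B η → ∫ x in B, w x * η x = ∫ x in B, lapv x * η x := by
    intro η hη
    have hint : ∀ {f ζ : RH n → ℝ}, MemLp f 2 (volume.restrict B) → Continuous ζ →
        Integrable (fun x => f x * ζ x) (volume.restrict B) := fun hf hζ =>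
      hf.integrable_mul (memLp_two_restrict_of_continuous hb hζ)
    have hΔ : Continuous (cLaplacian η) :=
      continuous_finsetSum _ fun i _ => ((hη.pderiv i).pderiv i).1.continuous
    rw [← hlapv η hη]
    simp only [hw, add_mul]
    rw [integral_add (hint hh2 hη.1.continuous) (hint he2 hη.1.continuous),
      ← H2.isWeakLaplacian hb η hη, show ∫ x in B, e x * η x = ∫ x in B, uHalf n hn x * cLaplacian η x from
        (isWeakLaplacian_half_sq_pos B N η hη).symm,
      ← integral_add (hint H2.1 hΔ) (hint hu2 hΔ)]
    refine integral_congr_ae (Eventually.of_forall fun x => ?_)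
    simp only [uHalf, ← hN]
    ring
  have hwint : ∫ x in B, w x = ∫ x in B, e x := by
    have hi : ∀ i, ∫ x in B, h i i x = 0 := fun i => by
      have hT := tendsto_integral_mul_of_eLpNorm (μ := volume.restrict B) (a := fun _ _ => 1)
        (b := fun _ => 1) (M := 1) (G := h i i) (g := fun k => cpderiv i (cpderiv i (φ k)))
        (fun _ => aestronglyMeasurable_const) (by simp) (by simp)
        ((H2.2.2 i i).2.integrable (by norm_num))
        (fun k => (((hφ k).pderiv i).pderiv i).1.continuous.aestronglyMeasurable) (l2 i i)
      simp only [one_mul, ((hφ _).pderiv i).setIntegral_cpderiv i] at hT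
      exact tendsto_nhds_unique hT tendsto_const_nhds
    rw [integral_add (hh2.integrable (by norm_num)) hei,
      integral_finsetSum _ fun i _ => (H2.2.2 i i).2.integrable (by norm_num)]
    simp [hi]
  have hlw : ∀ᵐ x ∂volume.restrict B, lapv x = w x := by
    refine (ae_eq_zero_or_ae_eq_of_forall_isTestFun isOpen_ball
      (hw2.integrable (by norm_num)) hwlap).resolve_left fun hw0 => ?_
    have h0 : ∫ x in B, e x = 0 := by
      rw [← hwint]
      exact integral_eq_zero_of_ae hw0
    rw [integral_eq_zero_iff_of_nonneg (fun x => by simp only [he]; split_ifs <;> simp) hei] at h0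
    refine not_ae_coord_nonpos_ball hR N ?_
    filter_upwards [h0] with x hx hpos
    simp [he, hpos] at hx
  have hwz : ∀ᵐ x ∂volume.restrict B, v x = 0 → w x = 0 := by
    have hφ' := fun k => (hφ k).1
    have A := ae_laplacian_eq_zero isOpen_ball hb H2.1 (fun i => (H2.2.1 i).2)
      (fun i j => (H2.2.2 i j).2) hφ' l0 l1 l2 (p := fun _ => 0) contDiff_const
    have A' := ae_laplacian_eq_zero isOpen_ball hb H2.1 (fun i => (H2.2.1 i).2)
      (fun i j => (H2.2.2 i j).2) hφ' l0 l1 l2 (p := fun x => (x N) ^ 2 / 2) (by fun_prop)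
    filter_upwards [A, A'] with x hx hx' hvx
    by_cases hpos : 0 < x N
    · have := hx' (by simp [uHalf, ← hN, hpos, hvx])
      rw [cLaplacian_half_sq] at this
      simpa [hw, he, hpos] using this
    · have := hx (by simp [uHalf, ← hN, hpos, hvx])
      simpa [hw, he, hpos, cLaplacian, cpderiv_const] using this
  have hu0 : ∀ x, e x = if uHalf n hn x ≠ 0 then 1 else 0 := fun x => by
    by_cases hpos : 0 < x N
    · simp [he, uHalf, ← hN, hpos, hpos.ne']
    · simp [he, uHalf, ← hN, hpos]
  have hFu : ACF B e (uHalf n hn) = 2 * ∫ x in B, e x := by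
    rw [(ACF_eq_integral_sq_add (Ω := B) measurableSet_ball hb.measure_lt_top.ne he2
      hucont.aestronglyMeasurable (Eventually.of_forall fun x hx => by simp [hu0, hx])).2]
    simp [← hu0]
  have hl2 : MemLp lapv 2 (volume.restrict B) := hw2.ae_eq (hlw.mono fun x hx => hx.symm)
  obtain ⟨hsq, hFv⟩ := ACF_eq_integral_sq_add (Ω := B) measurableSet_ball hb.measure_lt_top.ne hl2 hvm
    (by filter_upwards [hlw, hwz] with x h1 h2 h3 using h1.trans (h2 h3))
  rw [integral_congr_ae hlw, hwint] at hFv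
  have hnn : 0 ≤ ∫ x in B, (lapv x - if v x ≠ 0 then 1 else 0) ^ 2 :=
    integral_nonneg fun x => sq_nonneg _
  refine ⟨by rw [hFu, hFv]; linarith, ?_⟩
  rw [hFu, hFv, right_eq_add, integral_eq_zero_iff_of_nonneg (fun x => sq_nonneg _) hsq]
  refine ⟨fun h => h.mono fun x hx => ?_, fun h => h.mono fun x hx => ?_⟩
  · exact sub_eq_zero.1 (pow_eq_zero_iff two_ne_zero |>.1 hx)
  · simp [hx]

end
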